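/- arXiv:1910.02744 — 3 statements merged into one kernel-verified Lean document; each statement's English description precedes it below -/
import Mathlib

section
/- Let 0 < p̄ < λ, X̄ > 0, and D > 0 with D ≥ p̄·X̄/λ. Define l = (p̄²·X̄/(D·λ))·(√(1 + D²·λ²/(p̄²·X̄²)) − 1). Then 0 < l < p̄ and ∫_l^{p̄} (l·D)/(p²·min(p·X̄/λ, D)) dp = 1; moreover l is the unique number in (0, p̄) satisfying this equation. -/
theorem aux_integral (pbar lam Xbar D a : ℝ) (hlam : 0 < lam) (hXbar : 0 < Xbar)
    (hDge : pbar * Xbar / lam ≤ D) (ha : 0 < a) (hap : a < pbar) :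
    (∫ p in a..pbar, (a * D) / (p ^ 2 * min (p * Xbar / lam) D)) =
      a * D * lam / (2 * Xbar) * (1 / a ^ 2 - 1 / pbar ^ 2) := by
  have h1 : (∫ p in a..pbar, (a * D) / (p ^ 2 * min (p * Xbar / lam) D)) =
      ∫ p in a..pbar, (a * D * lam / Xbar) / p ^ 3 := by
    apply intervalIntegral.integral_congr
    intro p hp
    rw [Set.uIcc_of_le hap.le] at hp
    have hp0 : 0 < p := lt_of_lt_of_le ha hp.1
    have hle : p * Xbar / lam ≤ D := by
      refine le_trans ?_ hDge
      have := hp.2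
      gcongr
    simp only [min_eq_left hle]
    field_simp
  rw [h1]
  have h2 := intervalIntegral.integral_eq_sub_of_hasDerivAt (a := a) (b := pbar)
    (f := fun p : ℝ => -(a * D * lam / (2 * Xbar)) * (p ^ 2)⁻¹)
    (f' := fun p : ℝ => (a * D * lam / Xbar) / p ^ 3) ?_ ?_
  · rw [h2]
    ring
  · intro p hp
    rw [Set.uIcc_of_le hap.le] at hp
    have hp0 : 0 < p := lt_of_lt_of_le ha hp.1
    have h3 := (((hasDerivAt_pow 2 p).inv (by positivity)).const_mul
      (-(a * D * lam / (2 * Xbar))))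
    refine HasDerivAt.congr_deriv h3 ?_
    field_simp
    norm_num
  · apply ContinuousOn.intervalIntegrable
    intro p hp
    rw [Set.uIcc_of_le hap.le] at hp
    have hp0 : 0 < p := lt_of_lt_of_le ha hp.1
    apply ContinuousAt.continuousWithinAt
    exact continuousAt_const.div (by fun_prop) (by positivity)

theorem aux_iff (pbar lam Xbar D a : ℝ) (hlam : 0 < lam) (hXbar : 0 < Xbar)
    (hDge : pbar * Xbar / lam ≤ D) (ha : 0 < a) (hap : a < pbar) :
    (∫ p in a..pbar, (a * D) / (p ^ 2 * min (p * Xbar / lam) D)) = 1 ↔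
      D * lam * (pbar ^ 2 - a ^ 2) = 2 * Xbar * a * pbar ^ 2 := by
  rw [aux_integral pbar lam Xbar D a hlam hXbar hDge ha hap]
  have hp : 0 < pbar := ha.trans hap
  have : a * D * lam / (2 * Xbar) * (1 / a ^ 2 - 1 / pbar ^ 2) =
      (D * lam * (pbar ^ 2 - a ^ 2)) / (2 * Xbar * a * pbar ^ 2) := by
    field_simp
  rw [this, div_eq_one_iff_eq (by positivity)]

/-- Theorems 2–3, S₁S₀ subgame, case D ≥ p̄X̄/λ: the lower support
l = (p̄²X̄/(Dλ))·(√(1 + D²λ²/(p̄²X̄²)) − 1) satisfies 0 < l < p̄ and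
∫_l^{p̄} (lD)/(p²·min(pX̄/λ, D)) dp = 1, and is the unique such number in (0, p̄). -/
theorem mixed_equilibrium_lower_support_high_demand
    (pbar lam Xbar D : ℝ)
    (hpbar : 0 < pbar) (hplam : pbar < lam) (hXbar : 0 < Xbar)
    (hD : 0 < D) (hDge : pbar * Xbar / lam ≤ D) :
    let l := (pbar ^ 2 * Xbar / (D * lam)) *
      (Real.sqrt (1 + D ^ 2 * lam ^ 2 / (pbar ^ 2 * Xbar ^ 2)) - 1)
    0 < l ∧ l < pbar ∧
    (∫ p in l..pbar, (l * D) / (p ^ 2 * min (p * Xbar / lam) D)) = 1 ∧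
    ∀ l' ∈ Set.Ioo (0 : ℝ) pbar,
      (∫ p in l'..pbar, (l' * D) / (p ^ 2 * min (p * Xbar / lam) D)) = 1 → l' = l := by
  intro l
  have hlam : 0 < lam := hpbar.trans hplam
  obtain ⟨K, hK⟩ : ∃ K, K = D * lam / (pbar * Xbar) := ⟨_, rfl⟩
  have hK0 : 0 < K := by rw [hK]; positivity
  obtain ⟨s, hs⟩ : ∃ s, s = Real.sqrt (1 + K ^ 2) := ⟨_, rfl⟩
  have hs2 : s ^ 2 = 1 + K ^ 2 := by rw [hs]; exact Real.sq_sqrt (by positivity)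
  have hs0 : 0 ≤ s := by rw [hs]; positivity
  have hDl : D * lam = K * (pbar * Xbar) := by rw [hK]; field_simp
  have hl : l = pbar / K * (s - 1) := by
    have e1 : D ^ 2 * lam ^ 2 / (pbar ^ 2 * Xbar ^ 2) = K ^ 2 := by
      rw [hK]; field_simp
    have e2 : pbar ^ 2 * Xbar / (D * lam) = pbar / K := by
      rw [hDl]; field_simp
    simp only [l, e1, e2, hs]
  clear_value l
  have hs1 : 1 < s := by nlinarith
  have hsK : s < 1 + K := by nlinarith
  have hl0 : 0 < l := by
    rw [hl]; exact mul_pos (by positivity) (by linarith)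
  have hlp : l < pbar := by
    rw [hl, div_mul_eq_mul_div, div_lt_iff₀ hK0]
    exact mul_lt_mul_of_pos_left (by linarith) hpbar
  have hq : D * lam * (pbar ^ 2 - l ^ 2) = 2 * Xbar * l * pbar ^ 2 := by
    rw [hDl, hl]
    field_simp
    linear_combination (-1 : ℝ) * hs2
  refine ⟨hl0, hlp, (aux_iff pbar lam Xbar D l hlam hXbar hDge hl0 hlp).2 hq, ?_⟩
  rintro l' ⟨h0, h1⟩ h
  have hq' := (aux_iff pbar lam Xbar D l' hlam hXbar hDge h0 h1).1 h
  have hne : 0 < D * lam * (l + l') + 2 * Xbar * pbar ^ 2 := by positivity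
  have hz : (l' - l) * (D * lam * (l + l') + 2 * Xbar * pbar ^ 2) = 0 := by
    linear_combination hq - hq'
  rcases mul_eq_zero.1 hz with h | h
  · linarith
  · exact absurd h hne.ne'
end

section
/- Let 0 < p̄ < λ, X̄ > 0, and 0 < D < p̄·X̄/λ. Define l = D·λ/(X̄·(1 + √(2·D·λ/(p̄·X̄)))). Then 0 < l < D·λ/X̄ < p̄ and ∫_l^{p̄} (l·D)/(p²·min(p·X̄/λ, D)) dp = 1; moreover l is the unique number in (0, p̄) satisfying this equation. -/
lemma aux_cont (lam Xbar D c a b : ℝ) (hl : 0 < lam) (hX : 0 < Xbar) (hD : 0 < D)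
    (ha : 0 < a) (hab : a ≤ b) :
    IntervalIntegrable (fun p : ℝ => (c * D) / (p ^ 2 * min (p * Xbar / lam) D))
      MeasureTheory.volume a b := by
  apply ContinuousOn.intervalIntegrable
  rw [Set.uIcc_of_le hab]
  apply ContinuousOn.div (by fun_prop) (by fun_prop)
  intro p hp
  have hp0 : 0 < p := lt_of_lt_of_le ha hp.1
  have : 0 < min (p * Xbar / lam) D := lt_min (by positivity) hD
  positivity

lemma aux_low (lam Xbar D c a b : ℝ) (hl : 0 < lam) (hX : 0 < Xbar) (hD : 0 < D)
    (ha : 0 < a) (hab : a ≤ b) (hb : b ≤ D * lam / Xbar) :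
    ∫ p in a..b, (c * D) / (p ^ 2 * min (p * Xbar / lam) D)
      = c * (D * lam / Xbar) / 2 * (1 / a ^ 2 - 1 / b ^ 2) := by
  rw [intervalIntegral.integral_eq_sub_of_hasDerivAt
    (f := fun p => -(c * (D * lam / Xbar) / 2) * (p ^ 2)⁻¹) _
    (aux_cont lam Xbar D c a b hl hX hD ha hab)]
  · ring
  intro p hp
  rw [Set.uIcc_of_le hab] at hp
  have hp0 : 0 < p := lt_of_lt_of_le ha hp.1
  have hm : min (p * Xbar / lam) D = p * Xbar / lam := by
    apply min_eq_left
    have := hp.2.trans hb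
    rw [le_div_iff₀ hX] at this
    rwa [div_le_iff₀ hl]
  rw [hm]
  have h := (((hasDerivAt_id p).pow 2).inv (by simp; positivity)).const_mul
    (-(c * (D * lam / Xbar) / 2))
  refine HasDerivAt.congr_deriv h ?_
  simp
  field_simp

lemma aux_high (lam Xbar D c a b : ℝ) (hl : 0 < lam) (hX : 0 < Xbar) (hD : 0 < D)
    (ha : 0 < a) (hab : a ≤ b) (hma : D * lam / Xbar ≤ a) :
    ∫ p in a..b, (c * D) / (p ^ 2 * min (p * Xbar / lam) D)
      = c * (1 / a - 1 / b) := by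
  rw [intervalIntegral.integral_eq_sub_of_hasDerivAt
    (f := fun p => -c * p⁻¹) _
    (aux_cont lam Xbar D c a b hl hX hD ha hab)]
  · ring
  intro p hp
  rw [Set.uIcc_of_le hab] at hp
  have hp0 : 0 < p := lt_of_lt_of_le ha hp.1
  have hm : min (p * Xbar / lam) D = D := by
    apply min_eq_right
    have := hma.trans hp.1
    rw [div_le_iff₀ hX] at this
    rwa [le_div_iff₀ hl]
  rw [hm]
  have h := (hasDerivAt_inv hp0.ne').const_mul (-c)
  refine HasDerivAt.congr_deriv h ?_
  field_simp

/-- Theorems 2–3, S₁S₀ subgame, case D < p̄X̄/λ: the lower support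
l = Dλ/(X̄(1 + √(2Dλ/(p̄X̄)))) satisfies 0 < l < Dλ/X̄ < p̄ and
∫_l^{p̄} (lD)/(p²·min(pX̄/λ, D)) dp = 1, and is the unique such number in (0, p̄). -/
theorem mixed_equilibrium_lower_support_low_demand
    (pbar lam Xbar D : ℝ)
    (hpbar : 0 < pbar) (hplam : pbar < lam) (hXbar : 0 < Xbar)
    (hD : 0 < D) (hDlt : D < pbar * Xbar / lam) :
    let l := D * lam / (Xbar * (1 + Real.sqrt (2 * D * lam / (pbar * Xbar))))
    0 < l ∧ l < D * lam / Xbar ∧ D * lam / Xbar < pbar ∧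
    (∫ p in l..pbar, (l * D) / (p ^ 2 * min (p * Xbar / lam) D)) = 1 ∧
    ∀ l' ∈ Set.Ioo (0 : ℝ) pbar,
      (∫ p in l'..pbar, (l' * D) / (p ^ 2 * min (p * Xbar / lam) D)) = 1 → l' = l := by
  have hl : 0 < lam := hpbar.trans hplam
  have hmp : D * lam / Xbar < pbar := by
    rw [lt_div_iff₀ hl] at hDlt
    rwa [div_lt_iff₀ hXbar]
  have hm0 : 0 < D * lam / Xbar := by positivity
  have hs : 2 * D * lam / (pbar * Xbar) = 2 * (D * lam / Xbar) / pbar := by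
    field_simp
  have hlow : ∀ x, 0 < x → x ≤ D * lam / Xbar →
      ∫ p in x..pbar, (x * D) / (p ^ 2 * min (p * Xbar / lam) D)
        = x * (D * lam / Xbar) / 2 * (1 / x ^ 2 - 1 / (D * lam / Xbar) ^ 2)
          + x * (1 / (D * lam / Xbar) - 1 / pbar) := by
    intro x hx hxm
    rw [← aux_low lam Xbar D x x _ hl hXbar hD hx hxm le_rfl,
      ← aux_high lam Xbar D x _ pbar hl hXbar hD hm0 hmp.le le_rfl]
    exact (intervalIntegral.integral_add_adjacent_intervals
      (aux_cont lam Xbar D x _ _ hl hXbar hD hx hxm)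
      (aux_cont lam Xbar D x _ _ hl hXbar hD hm0 hmp.le)).symm
  intro l
  have hl_eq : l = (D * lam / Xbar) / (1 + Real.sqrt (2 * (D * lam / Xbar) / pbar)) := by
    simp only [l]
    rw [hs, div_div]
  clear_value l
  have hhigh := fun x => aux_high lam Xbar D x x pbar hl hXbar hD
  generalize D * lam / Xbar = m at *
  have hspos : 0 < Real.sqrt (2 * m / pbar) := Real.sqrt_pos.2 (by positivity)
  have hsq : Real.sqrt (2 * m / pbar) ^ 2 * pbar = 2 * m := by
    rw [Real.sq_sqrt (by positivity)]; field_simp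
  generalize Real.sqrt (2 * m / pbar) = s at *
  have hl0 : 0 < l := by rw [hl_eq]; positivity
  have hml : m = l * (1 + s) := by rw [hl_eq]; field_simp
  have hlm : l < m := by nlinarith [mul_pos hl0 hspos]
  have hiff : ∀ x, 0 < x → (x * m / 2 * (1 / x ^ 2 - 1 / m ^ 2) + x * (1 / m - 1 / pbar) = 1 ↔
      (m - x) ^ 2 = (x * s) ^ 2) := by
    intro x hx
    have e : x * m / 2 * (1 / x ^ 2 - 1 / m ^ 2) + x * (1 / m - 1 / pbar) - 1
        = ((m - x) ^ 2 - (x * s) ^ 2) / (2 * x * m) := by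
      have hs2 : s ^ 2 = 2 * m / pbar := by field_simp; linarith
      rw [mul_pow, hs2]
      field_simp
      ring
    rw [← sub_eq_zero, e, div_eq_zero_iff, sub_eq_zero]
    exact or_iff_left (by positivity)
  refine ⟨hl0, hlm, hmp, ?_, ?_⟩
  · rw [hlow l hl0 hlm.le, hiff l hl0, hml]
    ring
  · rintro x ⟨hx0, hxp⟩ hx
    rcases le_total x m with hxm | hxm
    · rw [hlow x hx0 hxm, hiff x hx0] at hx
      have h1 := (pow_left_inj₀ (by linarith) (by positivity) two_ne_zero).1 hx
      rw [hl_eq, eq_div_iff (by positivity)]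
      linarith
    · rw [hhigh x hx0 hxp.le hxm] at hx
      have : 0 < x / pbar := by positivity
      have h2 : x * (1 / x - 1 / pbar) = 1 - x / pbar := by field_simp
      linarith
end

section
/- Let 0 < p̄ < λ, X̄ > 0, and D ≥ p̄·X̄/λ, and let l = (p̄²·X̄/(D·λ))·(√(1 + D²·λ²/(p̄²·X̄²)) − 1). Then (l·D)/((X̄/(2·λ))·l²) = 2·λ·D/(X̄·l) = 2 + 2·√(1 + D²·λ²/(p̄²·X̄²)) ≥ 2 + 2·√2 > 4. -/
/-- Theorem 3 revenue-ratio bound, case Dλ/(p̄X̄) ≥ 1: with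
l = (p̄²X̄/(Dλ))·(√(1 + D²λ²/(p̄²X̄²)) − 1), the ratio (lD)/((X̄/(2λ))l²) = 2λD/(X̄l)
equals 2 + 2√(1 + D²λ²/(p̄²X̄²)), which is at least 2 + 2√2 > 4. -/
theorem revenue_ratio_bound_high_demand
    (pbar lam Xbar D : ℝ)
    (hpbar : 0 < pbar) (hplam : pbar < lam) (hXbar : 0 < Xbar)
    (hDge : pbar * Xbar / lam ≤ D) :
    let l := (pbar ^ 2 * Xbar / (D * lam)) *
      (Real.sqrt (1 + D ^ 2 * lam ^ 2 / (pbar ^ 2 * Xbar ^ 2)) - 1)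
    (l * D) / ((Xbar / (2 * lam)) * l ^ 2) = 2 * lam * D / (Xbar * l) ∧
    2 * lam * D / (Xbar * l) =
      2 + 2 * Real.sqrt (1 + D ^ 2 * lam ^ 2 / (pbar ^ 2 * Xbar ^ 2)) ∧
    2 + 2 * Real.sqrt 2 ≤
      2 + 2 * Real.sqrt (1 + D ^ 2 * lam ^ 2 / (pbar ^ 2 * Xbar ^ 2)) ∧
    (4 : ℝ) < 2 + 2 * Real.sqrt 2 := by
  intro l
  have hlam : 0 < lam := hpbar.trans hplam
  have hD : 0 < D := lt_of_lt_of_le (by positivity) hDge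
  have hk : pbar * Xbar ≤ D * lam := (div_le_iff₀ hlam).1 hDge
  have ht : 1 ≤ D ^ 2 * lam ^ 2 / (pbar ^ 2 * Xbar ^ 2) := by
    rw [le_div_iff₀ (by positivity), one_mul, ← mul_pow, ← mul_pow]
    exact pow_le_pow_left₀ (by positivity) hk 2
  have hs2 : Real.sqrt (1 + D ^ 2 * lam ^ 2 / (pbar ^ 2 * Xbar ^ 2)) ^ 2
      = 1 + D ^ 2 * lam ^ 2 / (pbar ^ 2 * Xbar ^ 2) := Real.sq_sqrt (by linarith)
  have hs1 : 1 < Real.sqrt (1 + D ^ 2 * lam ^ 2 / (pbar ^ 2 * Xbar ^ 2)) :=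
    Real.lt_sqrt_of_sq_lt (by linarith)
  have hmono : Real.sqrt 2 ≤ Real.sqrt (1 + D ^ 2 * lam ^ 2 / (pbar ^ 2 * Xbar ^ 2)) :=
    Real.sqrt_le_sqrt (by linarith)
  have h2 : 1 < Real.sqrt 2 := Real.lt_sqrt_of_sq_lt (by norm_num)
  have hl : l = (pbar ^ 2 * Xbar / (D * lam)) *
      (Real.sqrt (1 + D ^ 2 * lam ^ 2 / (pbar ^ 2 * Xbar ^ 2)) - 1) := rfl
  clear_value l
  generalize Real.sqrt (1 + D ^ 2 * lam ^ 2 / (pbar ^ 2 * Xbar ^ 2)) = s at *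
  have hs0 : 0 < s - 1 := by linarith
  have hlpos : 0 < l := by rw [hl]; positivity
  refine ⟨by field_simp, ?_, by linarith, by linarith⟩
  have hX : D ^ 2 * lam ^ 2 = (s ^ 2 - 1) * (pbar ^ 2 * Xbar ^ 2) := by
    rw [hs2]; field_simp; ring
  have hDl : D * lam * l = pbar ^ 2 * Xbar * (s - 1) := by
    rw [hl]; field_simp
  rw [div_eq_iff (by positivity)]
  have hDlam : D * lam ≠ 0 := by positivity
  apply mul_left_cancel₀ hDlam
  linear_combination 2 * hX - (2 + 2 * s) * Xbar * hDl
end
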